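/- For every polytope P in ℝ^d there exists a sequence (g_l)_{l=1}^∞ of polynomials in ℝ[x₁,…,x_d] such that: (ℐ) g_l(v) = 0 for every vertex v of P and every l; (𝒞) for every l the restriction of g_l to aff P is strictly concave; and (𝒜) the Hausdorff distance between P and {x ∈ aff P : g_l(x) ≥ 0} converges to 0 as l → ∞. -/

import Mathlib

open scoped RealInnerProductSpace Pointwise
open Metric Set

noncomputable section

/-- Euclidean space ℝ^d. -/
abbrev E (d : ℕ) : Type := EuclideanSpace ℝ (Fin d)

/-- Evaluation of a multivariate polynomial at a point of ℝ^d. -/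
def evalPoly {d : ℕ} (p : MvPolynomial (Fin d) ℝ) (x : E d) : ℝ :=
  MvPolynomial.eval (fun i => x i) p

/-- A polytope: the convex hull of a (nonempty) finite point set. -/
def IsPolytope {d : ℕ} (P : Set (E d)) : Prop :=
  ∃ V : Finset (E d), V.Nonempty ∧ P = convexHull ℝ (V : Set (E d))

/-- A polyhedron: a nonempty intersection of finitely many closed halfspaces. -/
def IsPolyhedron {d : ℕ} (P : Set (E d)) : Prop :=
  P.Nonempty ∧ ∃ (m : ℕ) (a : Fin m → E d) (b : Fin m → ℝ),
    P = {x : E d | ∀ i, ⟪a i, x⟫ ≤ b i}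

/-- Dimension of a set: the dimension of its affine hull. -/
def dimS {d : ℕ} (A : Set (E d)) : ℕ :=
  Module.finrank ℝ (affineSpan ℝ A).direction

/-- Faces of a polytope (= exposed subsets). -/
def IsFaceOf {d : ℕ} (P F : Set (E d)) : Prop := IsExposed ℝ P F

/-- A facet of an n-dimensional polytope: an (n−1)-dimensional face. -/
def IsFacetOf {d : ℕ} (P F : Set (E d)) : Prop :=
  IsExposed ℝ P F ∧ dimS F + 1 = dimS P

/-- A vertex: a 0-dimensional face. -/
def IsVertexOf {d : ℕ} (P : Set (E d)) (v : E d) : Prop := IsExposed ℝ P {v}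

/-- Support function h(P,u). -/
def suppF {d : ℕ} (P : Set (E d)) (u : E d) : ℝ := sSup ((fun x => ⟪u, x⟫) '' P)

/-- Exposed face F(P,u) of P in direction u. -/
def exposedSet {d : ℕ} (P : Set (E d)) (u : E d) : Set (E d) :=
  {x ∈ P | ⟪u, x⟫ = suppF P u}

/-- The unit outer normal u_F(P) of a facet G of P, parallel to aff P. -/
def outerNormal {d : ℕ} (P G : Set (E d)) : E d :=
  Classical.epsilon fun u : E d =>
    u ∈ (affineSpan ℝ P).direction ∧ ‖u‖ = 1 ∧ exposedSet P u = G

/-- q_G(P,x) := (h(P,u_G(P)) − ⟨u_G(P),x⟩)/diam(P). -/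
def qF {d : ℕ} (P G : Set (E d)) (x : E d) : ℝ :=
  (suppF P (outerNormal P G) - ⟪outerNormal P G, x⟫) / Metric.diam P

/-- Conical hull: all nonnegative combinations of points of A. -/
def coneHull {d : ℕ} (A : Set (E d)) : Set (E d) :=
  {x | ∃ (n : ℕ) (c : Fin n → ℝ) (p : Fin n → E d),
    (∀ i, 0 ≤ c i) ∧ (∀ i, p i ∈ A) ∧ x = ∑ i, c i • p i}

/-- Supporting cone S(P,v) := cone (P − v). -/
def suppCone {d : ℕ} (P : Set (E d)) (v : E d) : Set (E d) :=
  coneHull ((fun x => x - v) '' P)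

/-- F⁻(P,x): the facets of P visible from x. -/
def visFacets {d : ℕ} (P : Set (E d)) (x : E d) : Set (Set (E d)) :=
  {G | IsFacetOf P G ∧ qF P G x ≤ 0}

/-- The facets of P containing the set A. -/
def facetsCont {d : ℕ} (P A : Set (E d)) : Set (Set (E d)) :=
  {G | IsFacetOf P G ∧ A ⊆ G}

/-- u_G(P): the normalized sum of the outer facet normals over facets containing G. -/
def uface {d : ℕ} (P G : Set (E d)) : E d :=
  ‖∑ᶠ F ∈ facetsCont P G, outerNormal P F‖⁻¹ • ∑ᶠ F ∈ facetsCont P G, outerNormal P F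

/-- The hyperplane H_v(P) := {x : ⟨x, u_v(P)⟩ = −1}. -/
def Hv {d : ℕ} (P : Set (E d)) (v : E d) : Set (E d) :=
  {x : E d | ⟪x, uface P {v}⟫ = -1}

/-- P_v := S(P,v) ∩ H_v(P). -/
def vertFig {d : ℕ} (P : Set (E d)) (v : E d) : Set (E d) :=
  suppCone P v ∩ Hv P v

/-- S_ρ(P,v) := cone((P_v + B(o,ρ)) ∩ H_v(P)). -/
def Srho {d : ℕ} (P : Set (E d)) (v : E d) (ρ : ℝ) : Set (E d) :=
  coneHull ((vertFig P v + Metric.closedBall (0 : E d) ρ) ∩ Hv P v)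

/-- Condition 𝒜(P): Hausdorff distance between P and {x ∈ aff P : g_l(x) ≥ 0} tends to 0. -/
def condA {d : ℕ} (P : Set (E d)) (g : ℕ → MvPolynomial (Fin d) ℝ) : Prop :=
  Filter.Tendsto
    (fun l => Metric.hausdorffDist P
      {x ∈ (affineSpan ℝ P : Set (E d)) | 0 ≤ evalPoly (g l) x})
    Filter.atTop (nhds 0)

/-- Condition ℐ(P): each g_l vanishes on all vertices of P. -/
def condI {d : ℕ} (P : Set (E d)) (g : ℕ → MvPolynomial (Fin d) ℝ) : Prop :=
  ∀ (l : ℕ) (v : E d), IsVertexOf P v → evalPoly (g l) v = 0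

/-- Condition 𝒞(P): each g_l is strictly concave on aff P. -/
def condC {d : ℕ} (P : Set (E d)) (g : ℕ → MvPolynomial (Fin d) ℝ) : Prop :=
  ∀ l : ℕ, StrictConcaveOn ℝ (affineSpan ℝ P : Set (E d)) (evalPoly (g l))

/-- functions given by polynomials -/
def IsPolyFun {d : ℕ} (f : E d → ℝ) : Prop :=
  ∃ q : MvPolynomial (Fin d) ℝ, ∀ x, evalPoly q x = f x

/-- affine functions -/
def IsAff {d : ℕ} (f : E d → ℝ) : Prop :=
  ∃ (l : E d →L[ℝ] ℝ) (a b : ℝ), ∀ x, f x = a + b * l x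

lemma IsPolyFun.const {d : ℕ} (c : ℝ) : IsPolyFun (fun _ : E d => c) :=
  ⟨MvPolynomial.C c, fun x => by simp [evalPoly]⟩

lemma IsPolyFun.coord {d : ℕ} (i : Fin d) : IsPolyFun (fun x : E d => x i) :=
  ⟨MvPolynomial.X i, fun x => by simp [evalPoly]⟩

lemma IsPolyFun.add {d : ℕ} {f g : E d → ℝ} (hf : IsPolyFun f) (hg : IsPolyFun g) :
    IsPolyFun (fun x => f x + g x) := by
  obtain ⟨p, hp⟩ := hf
  obtain ⟨q, hq⟩ := hg
  exact ⟨p + q, fun x => by simp only [← hp, ← hq]; simp [evalPoly]⟩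

lemma IsPolyFun.mul {d : ℕ} {f g : E d → ℝ} (hf : IsPolyFun f) (hg : IsPolyFun g) :
    IsPolyFun (fun x => f x * g x) := by
  obtain ⟨p, hp⟩ := hf
  obtain ⟨q, hq⟩ := hg
  exact ⟨p * q, fun x => by simp only [← hp, ← hq]; simp [evalPoly]⟩

lemma IsPolyFun.pow {d : ℕ} {f : E d → ℝ} (hf : IsPolyFun f) (n : ℕ) :
    IsPolyFun (fun x => f x ^ n) := by
  obtain ⟨p, hp⟩ := hf
  exact ⟨p ^ n, fun x => by simp only [← hp]; simp [evalPoly]⟩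

lemma IsPolyFun.sum {d : ℕ} {ι : Type*} (s : Finset ι) {f : ι → E d → ℝ}
    (hf : ∀ i, IsPolyFun (f i)) : IsPolyFun (fun x => ∑ i ∈ s, f i x) := by
  choose p hp using hf
  refine ⟨∑ i ∈ s, p i, fun x => ?_⟩
  simp only [← hp]
  simp [evalPoly]

lemma IsAff.isPolyFun {d : ℕ} {f : E d → ℝ} (hf : IsAff f) : IsPolyFun f := by
  obtain ⟨l, a, b, h⟩ := hf
  have hl : ∀ x, l x = ∑ i, x i * l (EuclideanSpace.single i 1) := by
    intro x
    conv_lhs => rw [← (EuclideanSpace.basisFun (Fin d) ℝ).sum_repr x]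
    simp
  have : f = fun x => a + b * ∑ i, x i * l (EuclideanSpace.single i 1) := by
    funext x; rw [h, hl]
  rw [this]
  exact (IsPolyFun.const a).add ((IsPolyFun.const b).mul
    (IsPolyFun.sum _ fun i => (IsPolyFun.coord i).mul (IsPolyFun.const _)))

lemma IsAff.convexOn_pow {d : ℕ} {f : E d → ℝ} (hf : IsAff f) (k : ℕ) :
    ConvexOn ℝ univ (fun x => f x ^ (2 * k)) := by
  obtain ⟨l, a, b, h⟩ := hf
  have h1 : ConvexOn ℝ univ (fun x : ℝ => x ^ (2 * k)) := Even.convexOn_pow (even_two_mul k)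
  refine ⟨convex_univ, fun x _ y _ s t hs ht hst => ?_⟩
  have := h1.2 (mem_univ (f x)) (mem_univ (f y)) hs ht hst
  have e : f (s • x + t • y) = s • f x + t • f y := by
    simp only [h, map_add, map_smul, smul_eq_mul]
    linear_combination (-a) * hst
  simpa only [e] using this

lemma strictConvexOn_normsq {d : ℕ} {δ : ℝ} (hδ : 0 < δ) :
    StrictConvexOn ℝ univ (fun x : E d => δ * ‖x‖ ^ 2) := by
  have : StrongConvexOn (univ : Set (E d)) (2 * δ) (fun x : E d => δ * ‖x‖ ^ 2) := by
    rw [strongConvexOn_iff_convex]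
    have : (fun x : E d => δ * ‖x‖ ^ 2 - 2 * δ / 2 * ‖x‖ ^ 2) = fun _ => 0 := by
      funext x; ring
    rw [this]
    exact convexOn_const 0 convex_univ
  exact this.strictConvexOn (by linarith)

lemma isPolyFun_normsq {d : ℕ} (δ : ℝ) : IsPolyFun (fun x : E d => δ * ‖x‖ ^ 2) := by
  have : (fun x : E d => δ * ‖x‖ ^ 2) = fun x => δ * ∑ i, x i ^ 2 := by
    funext x; rw [EuclideanSpace.real_norm_sq_eq]
  rw [this]
  exact (IsPolyFun.const _).mul (IsPolyFun.sum _ fun i => (IsPolyFun.coord i).pow 2)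

lemma convexOn_fsum {d : ℕ} {ι : Type*} (s : Finset ι) {f : ι → E d → ℝ}
    (hf : ∀ i, ConvexOn ℝ univ (f i)) : ConvexOn ℝ univ (fun x => ∑ i ∈ s, f i x) := by
  classical
  induction s using Finset.induction_on with
  | empty => simpa using convexOn_const (0 : ℝ) convex_univ
  | insert a s ha ih =>
    simp only [Finset.sum_insert ha]
    exact (hf a).add ih

lemma solve_pos {W : Type*} [Fintype W] [DecidableEq W] (A : ℕ → Matrix W W ℝ) (b : ℕ → W → ℝ)
    (hA : Filter.Tendsto A Filter.atTop (nhds 1))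
    (hb : Filter.Tendsto b Filter.atTop (nhds (fun _ => 1))) :
    ∀ᶠ k in Filter.atTop, ∃ c : W → ℝ, (∀ v, 0 < c v) ∧ (A k).mulVec c = b k := by
  have hdet : Filter.Tendsto (fun k => (A k).det) Filter.atTop (nhds 1) := by
    have := ((continuous_id (X := Matrix W W ℝ)).matrix_det.tendsto 1).comp hA
    simpa [Function.comp_def] using this
  have hadj : Filter.Tendsto (fun k => (A k).adjugate) Filter.atTop (nhds 1) := by
    have := ((continuous_id (X := Matrix W W ℝ)).matrix_adjugate.tendsto 1).comp hA
    simpa [Function.comp_def] using this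
  have h2 : Filter.Tendsto (fun k => (A k).adjugate.mulVec (b k)) Filter.atTop
      (nhds ((1 : Matrix W W ℝ).mulVec fun _ => 1)) := by
    refine tendsto_pi_nhds.2 fun v => ?_
    simp only [Matrix.mulVec, dotProduct]
    refine tendsto_finsetSum _ fun w _ => ?_
    exact (tendsto_pi_nhds.1 (tendsto_pi_nhds.1 hadj v) w).mul (tendsto_pi_nhds.1 hb w)
  rw [Matrix.one_mulVec] at h2
  have e1 : ∀ᶠ k in Filter.atTop, ∀ v, 0 < (A k).adjugate.mulVec (b k) v := by
    rw [Filter.eventually_all]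
    intro v
    exact ((tendsto_pi_nhds.1 h2) v).eventually (lt_mem_nhds one_pos)
  have e2 : ∀ᶠ k in Filter.atTop, 0 < (A k).det := hdet.eventually (lt_mem_nhds one_pos)
  filter_upwards [e1, e2] with k hk1 hk2
  refine ⟨((A k).det)⁻¹ • ((A k).adjugate.mulVec (b k)), fun v => ?_, ?_⟩
  · exact mul_pos (inv_pos.2 hk2) (hk1 v)
  · rw [Matrix.mulVec_smul, Matrix.mulVec_mulVec, Matrix.mul_adjugate, Matrix.smul_mulVec,
      Matrix.one_mulVec, smul_smul, inv_mul_cancel₀ hk2.ne', one_smul]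

lemma core {d : ℕ} (W : Finset (E d)) (s : W → E d → ℝ) (hs : ∀ v, IsAff (s v))
    (hs1 : ∀ v : W, s v v = 1) (hs2 : ∀ v w : W, v ≠ w → |s v w| < 1)
    {ι : Type*} (T : Finset ι) (r : ι → E d → ℝ) (hr : ∀ i, IsAff (r i))
    (hr1 : ∀ i, ∀ w ∈ W, |r i w| < 1) :
    ∃ q : MvPolynomial (Fin d) ℝ, (∀ w ∈ W, evalPoly q w = 0) ∧
      StrictConvexOn ℝ univ (evalPoly q) ∧
      ∀ x, (∃ i ∈ T, 1 < r i x) → 0 < evalPoly q x := by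
  classical
  let p : ℕ → E d → ℝ := fun k x =>
    ∑ i ∈ T, r i x ^ (2 * k) + (1 / ((k : ℝ) + 1)) * ‖x‖ ^ 2
  let A : ℕ → Matrix W W ℝ := fun k => Matrix.of fun w v => s v w ^ (2 * k)
  let b : ℕ → W → ℝ := fun k w => 1 - p k w
  have hpow : ∀ a : ℝ, |a| < 1 →
      Filter.Tendsto (fun k : ℕ => a ^ (2 * k)) Filter.atTop (nhds 0) := by
    intro a ha
    have h2 : |a ^ 2| < 1 := by
      rw [abs_pow]; exact pow_lt_one₀ (abs_nonneg _) ha two_ne_zero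
    simpa only [pow_mul] using tendsto_pow_atTop_nhds_zero_of_abs_lt_one h2
  have hb : Filter.Tendsto b Filter.atTop (nhds (fun _ => 1)) := by
    rw [tendsto_pi_nhds]
    intro w
    have h1 : Filter.Tendsto (fun k => p k w) Filter.atTop
        (nhds (∑ i ∈ T, (0:ℝ) + 0 * ‖(w : E d)‖ ^ 2)) :=
      (tendsto_finsetSum _ fun i _ => hpow _ (hr1 i w w.2)).add
        (tendsto_one_div_add_atTop_nhds_zero_nat.mul_const _)
    have := h1.const_sub 1
    simpa using this
  have hA : Filter.Tendsto A Filter.atTop (nhds 1) := by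
    refine tendsto_pi_nhds.2 fun w => tendsto_pi_nhds.2 fun v => ?_
    by_cases h : v = w
    · subst h
      simp [A, hs1]
    · rw [Matrix.one_apply_ne (Ne.symm h)]
      exact hpow _ (hs2 v w h)
  obtain ⟨k, ⟨c, hk1, hsolve⟩, hk0⟩ :=
    ((solve_pos A b hA hb).and (Filter.eventually_gt_atTop 0)).exists
  have hδ : 0 < 1 / ((k : ℝ) + 1) := by positivity
  let F : E d → ℝ := fun x => (-1 + ∑ v, c v * s v x ^ (2 * k)) + p k x
  have hF : IsPolyFun F :=
    ((IsPolyFun.const _).add (IsPolyFun.sum _ fun v =>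
      (IsPolyFun.const _).mul ((hs v).isPolyFun.pow _))).add
      ((IsPolyFun.sum _ fun i => (hr i).isPolyFun.pow _).add (isPolyFun_normsq _))
  obtain ⟨q, hq⟩ := hF
  have hqF : evalPoly q = F := funext hq
  refine ⟨q, ?_, ?_, ?_⟩
  · intro w hw
    rw [hqF]
    have := congrFun hsolve ⟨w, hw⟩
    simp only [Matrix.mulVec, dotProduct, A, b, Matrix.of_apply] at this
    simp only [F]
    have e : ∑ v, c v * s v w ^ (2 * k) = ∑ v, s v w ^ (2 * k) * c v :=
      Finset.sum_congr rfl fun v _ => mul_comm _ _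
    rw [e, this]; ring
  · rw [hqF]
    refine ConvexOn.add_strictConvexOn ((convexOn_const (-1) convex_univ).add
      (convexOn_fsum _ fun v => ((hs v).convexOn_pow k).smul (hk1 v).le)) ?_
    exact ConvexOn.add_strictConvexOn (convexOn_fsum _ fun i => (hr i).convexOn_pow k)
      (strictConvexOn_normsq hδ)
  · rintro x ⟨i, hi, hx⟩
    rw [hqF]
    have h1 : 1 < r i x ^ (2 * k) := one_lt_pow₀ hx (by omega)
    have h2 : r i x ^ (2 * k) ≤ ∑ i ∈ T, r i x ^ (2 * k) :=
      Finset.single_le_sum (f := fun i => r i x ^ (2 * k))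
        (fun j _ => (even_two_mul k).pow_nonneg _) hi
    have h3 : 0 ≤ ∑ v, c v * s v x ^ (2 * k) :=
      Finset.sum_nonneg fun v _ => mul_nonneg (hk1 v).le ((even_two_mul k).pow_nonneg _)
    have h4 : 0 ≤ (1 / ((k : ℝ) + 1)) * ‖x‖ ^ 2 := by positivity
    simp only [F, p]
    linarith

lemma exists_scale {d : ℕ} (W : Finset (E d)) (l : E d →L[ℝ] ℝ) (u : ℝ)
    (h : ∀ w ∈ W, l w < u) : ∃ τ : ℝ, 0 < τ ∧ ∀ w ∈ W, |1 + τ * (l w - u)| < 1 := by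
  have hev : ∀ᶠ τ : ℝ in nhdsWithin 0 (Ioi 0), ∀ w ∈ W, |1 + τ * (l w - u)| < 1 := by
    rw [Filter.eventually_all_finset]
    intro w hw
    have hc : Continuous fun τ : ℝ => 1 + τ * (l w - u) := by fun_prop
    have h1 : ∀ᶠ τ : ℝ in nhdsWithin 0 (Ioi 0), -1 < 1 + τ * (l w - u) :=
      nhdsWithin_le_nhds ((hc.tendsto 0).eventually (lt_mem_nhds (by norm_num)))
    filter_upwards [h1, self_mem_nhdsWithin] with τ h2 h3
    have h3' : 0 < τ := h3
    rw [abs_lt]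
    refine ⟨h2, ?_⟩
    have := mul_neg_of_pos_of_neg h3' (sub_neg.2 (h w hw))
    linarith
  obtain ⟨τ, h1, h2⟩ := (hev.and self_mem_nhdsWithin).exists
  exact ⟨τ, h2, h1⟩

lemma isAff_scale {d : ℕ} (l : E d →L[ℝ] ℝ) (u τ : ℝ) :
    IsAff (fun x => 1 + τ * (l x - u)) :=
  ⟨l, 1 - τ * u, τ, fun x => by ring⟩

lemma main_eps {d : ℕ} (P : Set (E d)) (hP : IsPolytope P) (ε : ℝ) (hε : 0 < ε) :
    ∃ q : MvPolynomial (Fin d) ℝ, (∀ w ∈ P.extremePoints ℝ, evalPoly q w = 0) ∧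
      StrictConvexOn ℝ univ (evalPoly q) ∧ (∀ x ∈ P, evalPoly q x ≤ 0) ∧
      ∀ x, evalPoly q x ≤ 0 → infDist x P ≤ ε := by
  classical
  obtain ⟨V, hV, rfl⟩ := hP
  set P := convexHull ℝ (V : Set (E d)) with hPdef
  have hPc : IsCompact P := V.finite_toSet.isCompact_convexHull ℝ
  have hPconv : Convex ℝ P := convex_convexHull ℝ _
  have hPne : P.Nonempty := hV.to_set.convexHull
  have hfin : (P.extremePoints ℝ).Finite := V.finite_toSet.subset extremePoints_convexHull_subset
  set W := hfin.toFinset with hWdef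
  have hW : ∀ w, w ∈ W ↔ w ∈ P.extremePoints ℝ := fun w => by simp [W]
  have hWP : ∀ w ∈ W, w ∈ P := fun w hw => ((hW w).1 hw).1
  have hhull : convexHull ℝ (P.extremePoints ℝ) = P := by
    have := closure_convexHull_extremePoints hPc hPconv
    rwa [(hfin.isCompact_convexHull ℝ).isClosed.closure_eq] at this
  -- vertex functions
  have hvert : ∀ v : W, ∃ s : E d → ℝ, IsAff s ∧ s v = 1 ∧ ∀ w : W, v ≠ w → |s w| < 1 := by
    intro v
    have hv := (hPconv.mem_extremePoints_iff_convex_sdiff).1 ((hW v).1 v.2)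
    have hsub : convexHull ℝ ((W.erase v : Finset (E d)) : Set (E d)) ⊆ P \ {(v : E d)} := by
      refine convexHull_min ?_ hv.2
      intro w hw
      have hw' := Finset.mem_erase.1 (Finset.mem_coe.1 hw)
      exact ⟨hWP w hw'.2, hw'.1⟩
    have hnot : (v : E d) ∉ convexHull ℝ ((W.erase v : Finset (E d)) : Set (E d)) :=
      fun h => (hsub h).2 rfl
    obtain ⟨l, u, h1, h2⟩ := geometric_hahn_banach_closed_point (convex_convexHull ℝ _)
      ((W.erase (v : E d)).finite_toSet.isCompact_convexHull ℝ).isClosed hnot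
    obtain ⟨τ, hτ, h3⟩ := exists_scale (W.erase (v : E d)) l (l v) fun w hw =>
      (h1 w (subset_convexHull ℝ _ hw)).trans h2
    refine ⟨_, isAff_scale l (l v) τ, by simp, fun w hw => h3 w ?_⟩
    exact Finset.mem_erase.2 ⟨fun h => hw (Subtype.ext h.symm), w.2⟩
  choose s hs hs1 hs2 using hvert
  -- shell functions
  let K : Set (E d) := {x | infDist x P = ε}
  have hK : IsCompact K := by
    refine Metric.isCompact_of_isClosed_isBounded
      (isClosed_eq (continuous_infDist_pt P) continuous_const) ?_
    refine (hPc.isBounded.cthickening (δ := ε)).subset ?_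
    intro x hx
    rw [mem_cthickening_iff, ← ENNReal.ofReal_toReal (infEDist_ne_top hPne)]
    exact ENNReal.ofReal_le_ofReal (le_of_eq hx)
  have hshell : ∀ z : K, ∃ r : E d → ℝ, IsAff r ∧ (∀ w ∈ W, |r w| < 1) ∧
      (∀ y ∈ P, r y < 1) ∧ 1 < r z := by
    intro z
    have hz : (z : E d) ∉ P := by
      intro h
      have h1 : infDist (z : E d) P = ε := z.2
      rw [infDist_zero_of_mem h] at h1
      linarith
    obtain ⟨l, u, h1, h2⟩ := geometric_hahn_banach_closed_point hPconv hPc.isClosed hz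
    obtain ⟨τ, hτ, h3⟩ := exists_scale W l u fun w hw => h1 w (hWP w hw)
    refine ⟨_, isAff_scale l u τ, h3, fun y hy => ?_, ?_⟩
    · have := mul_neg_of_pos_of_neg hτ (sub_neg.2 (h1 y hy))
      linarith
    · have := mul_pos hτ (sub_pos.2 h2)
      linarith
  choose r hr hr1 hr2 hr3 using hshell
  have hrcont : ∀ z, Continuous (r z) := by
    intro z
    obtain ⟨l, a, b, h⟩ := hr z
    rw [funext h]
    fun_prop
  obtain ⟨T, hT⟩ := hK.elim_finite_subcover (fun z : K => {x | 1 < r z x})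
    (fun z => isOpen_lt continuous_const (hrcont z))
    (fun z hz => mem_iUnion.2 ⟨⟨z, hz⟩, hr3 ⟨z, hz⟩⟩)
  obtain ⟨q, hq1, hq2, hq3⟩ := core W s hs hs1 hs2 T r hr hr1
  refine ⟨q, fun w hw => hq1 w ((hW w).2 hw), hq2, ?_, ?_⟩
  · have hc : Convex ℝ {x ∈ univ | evalPoly q x ≤ 0} := hq2.convexOn.convex_le 0
    intro x hx
    rw [← hhull] at hx
    have hsub : P.extremePoints ℝ ⊆ {x ∈ univ | evalPoly q x ≤ 0} :=
      fun w hw => ⟨mem_univ _, (hq1 w ((hW w).2 hw)).le⟩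
    exact (convexHull_min hsub hc hx).2
  · intro x hx
    by_contra! hlt
    obtain ⟨y, hy⟩ := hPne
    have hcont : Continuous fun t : ℝ => infDist (y + t • (x - y)) P :=
      (continuous_infDist_pt P).comp (by fun_prop)
    have hmem : ε ∈ Icc (infDist (y + (0:ℝ) • (x - y)) P) (infDist (y + (1:ℝ) • (x - y)) P) := by
      simp only [zero_smul, one_smul, add_zero, add_sub_cancel, infDist_zero_of_mem hy]
      exact ⟨hε.le, hlt.le⟩
    obtain ⟨t, ht, hte⟩ := intermediate_value_Icc zero_le_one hcont.continuousOn hmem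
    obtain ⟨z, hzT, hz⟩ := mem_iUnion₂.1 (hT (show y + t • (x - y) ∈ K from hte))
    have hz' : 1 < r z (y + t • (x - y)) := hz
    have hy1 := hr2 z y hy
    have hx1 : 1 < r z x := by
      obtain ⟨l, a, b, h⟩ := hr z
      have e : r z (y + t • (x - y)) = (1 - t) * r z y + t * r z x := by
        simp only [h, map_add, map_smul, map_sub, smul_eq_mul]; ring
      rw [e] at hz'
      by_contra! hle
      have := mul_le_mul_of_nonneg_left hle ht.1
      have := mul_le_mul_of_nonneg_left hy1.le (sub_nonneg.2 ht.2)
      linarith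
    have := hq3 x ⟨z, hzT, hx1⟩
    linarith

/-- For every polytope P in ℝ^d there is a sequence of polynomials
satisfying ℐ(P), 𝒞(P) and 𝒜(P). -/
theorem exists_seq_AIC {d : ℕ} (P : Set (E d)) (hP : IsPolytope P) :
    ∃ g : ℕ → MvPolynomial (Fin d) ℝ, condI P g ∧ condC P g ∧ condA P g := by
  have hpos : ∀ n : ℕ, 0 < 1 / ((n : ℝ) + 1) := fun n => by positivity
  choose q hq1 hq2 hq3 hq4 using fun n : ℕ => main_eps P hP (1 / ((n : ℝ) + 1)) (hpos n)
  have hneg : ∀ n x, evalPoly (-q n) x = - evalPoly (q n) x := fun n x => by simp [evalPoly]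
  refine ⟨fun n => -q n, ?_, ?_, ?_⟩
  · intro n v hv
    rw [hneg, hq1 n v, neg_zero]
    exact isExtreme_singleton.1 (IsExposed.isExtreme hv)
  · intro n
    have h := (hq2 n).neg
    have e : evalPoly (-q n) = -evalPoly (q n) := funext (hneg n)
    rw [e]
    exact h.subset (subset_univ _) (affineSpan ℝ P).convex
  · refine squeeze_zero (fun n => hausdorffDist_nonneg) (fun n => ?_)
      tendsto_one_div_add_atTop_nhds_zero_nat
    refine hausdorffDist_le_of_infDist (hpos n).le ?_ ?_
    · intro x hx
      rw [infDist_zero_of_mem]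
      · exact (hpos n).le
      · refine ⟨subset_affineSpan ℝ P hx, ?_⟩
        rw [hneg]
        linarith [hq3 n x hx]
    · rintro x ⟨_, hx⟩
      rw [hneg] at hx
      exact hq4 n x (by linarith)
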